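/- Let m > n > 0 be integers. Let τ₁, …, τ_n, β₁, …, β_n, ε be real numbers with τ_i > 0 for all i, ε > 0, τ₁ + … + τ_n ≤ m − n, and β₁ + … + β_n = (1+ε)(m − 1). Then for almost every n-tuple (e₁, …, e_n) ∈ (ℝ^m)^n (with respect to mn-dimensional Lebesgue measure) there exist constants c, C > 0 such that for every sufficiently large integer Q there exist m linearly independent vectors q^{(1)}, …, q^{(m)} ∈ ℤ^m satisfying, for every j ∈ {1,…,m}: ‖q^{(j)}‖ ≤ C·Q, and c·Q^{−τ_i}(log Q)^{β_i − (1+ε)m} ≤ |q^{(j)} · e_i| ≤ C·Q^{−τ_i}(log Q)^{β_i} for all i ∈ {1,…,n}. -/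

import Mathlib

open MeasureTheory Filter

lemma vol_strip {m : ℕ} (q : Fin m → ℝ) (j : Fin m) (hq : q j ≠ 0) (M δ : ℝ)
    (hM : 0 ≤ M) (hδ : 0 ≤ δ) :
    volume {v : Fin m → ℝ | (∀ k, |v k| ≤ M) ∧ |∑ k, q k * v k| ≤ δ} ≤
      ENNReal.ofReal ((2 * M) ^ (m - 1) * (2 * δ) / |q j|) := by
  set Mat : Matrix (Fin m) (Fin m) ℝ := (1 : Matrix (Fin m) (Fin m) ℝ).updateRow j q with hMat
  have hdet : LinearMap.det (Matrix.toLin' Mat) = q j := by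
    rw [LinearMap.det_toLin', hMat, ← Matrix.cramer_transpose_apply]
    simp
  set b : Fin m → ℝ := Function.update (fun _ => M) j δ with hb
  have hsub : {v : Fin m → ℝ | (∀ k, |v k| ≤ M) ∧ |∑ k, q k * v k| ≤ δ} ⊆
      (Matrix.toLin' Mat) ⁻¹' (Set.Icc (fun k => - b k) b) := by
    rintro v ⟨h1, h2⟩
    have key : ∀ k, |(Matrix.toLin' Mat v) k| ≤ b k := by
      intro k
      by_cases hk : k = j
      · subst hk
        simpa [hMat, hb, Matrix.mulVec, dotProduct] using h2
      · have : (Matrix.toLin' Mat v) k = v k := by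
          simp [hMat, Matrix.mulVec, dotProduct, Matrix.updateRow_ne hk, Matrix.one_apply]
        rw [this, hb, Function.update_of_ne hk]
        exact h1 k
    exact ⟨fun k => (abs_le.1 (key k)).1, fun k => (abs_le.1 (key k)).2⟩
  refine (measure_mono hsub).trans ?_
  rw [Measure.addHaar_preimage_linearMap _ (by rw [hdet]; exact hq), hdet, Real.volume_Icc_pi,
    ← ENNReal.ofReal_prod_of_nonneg, ← ENNReal.ofReal_mul (abs_nonneg _)]
  · apply le_of_eq
    congr 1
    have : ∏ i, (b i - -b i) = (2 * M) ^ (m - 1) * (2 * δ) := by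
      rw [← Finset.prod_erase_mul _ _ (Finset.mem_univ j)]
      congr 1
      · rw [Finset.prod_congr rfl (g := fun _ => 2 * M)]
        · simp
        · intro x hx
          rw [hb, Function.update_of_ne (Finset.ne_of_mem_erase hx)]; ring
      · simp [hb]; ring
    rw [this, abs_inv, div_eq_inv_mul]
  · intro i _
    by_cases hi : i = j
    · subst hi; simp [hb]; linarith
    · simp [hb, hi]; linarith

lemma packing {E ι : Type*} [NormedAddCommGroup E] [NormedSpace ℝ E] [FiniteDimensional ℝ E]
    (s : Finset ι) (f : ι → E) (A l : ℝ) (hA : 0 ≤ A) (hl : 0 < l)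
    (hs : ∀ c ∈ s, ‖f c‖ ≤ A)
    (h : ∀ c ∈ s, ∀ d ∈ s, c ≠ d → l ≤ ‖f c - f d‖) :
    (s.card : ℝ) ≤ (1 + 2 * A / l) ^ Module.finrank ℝ E := by
  borelize E
  let μ : Measure E := Measure.addHaar
  let δ : ℝ := l / 2
  let ρ : ℝ := A + l / 2
  have ρpos : 0 < ρ := by positivity
  have δpos : 0 < δ := by positivity
  set B : Set E := ⋃ c ∈ s, Metric.ball (f c) δ with hB
  have D : Set.Pairwise (s : Set ι) (Function.onFun Disjoint fun c => Metric.ball (f c) δ) := by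
    rintro c hc d hd hcd
    apply Metric.ball_disjoint_ball
    rw [dist_eq_norm]
    convert h c hc d hd hcd
    simp [δ]
  have A1 : B ⊆ Metric.ball (0 : E) ρ := by
    refine Set.iUnion₂_subset fun x hx => ?_
    apply Metric.ball_subset_ball'
    have := hs x hx
    simp only [dist_zero_right, δ, ρ]
    linarith
  have I : (s.card : ENNReal) * ENNReal.ofReal (δ ^ Module.finrank ℝ E) * μ (Metric.ball 0 1) ≤
      ENNReal.ofReal (ρ ^ Module.finrank ℝ E) * μ (Metric.ball 0 1) :=
    calc
      (s.card : ENNReal) * ENNReal.ofReal (δ ^ Module.finrank ℝ E) * μ (Metric.ball 0 1) = μ B := by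
        rw [hB, measure_biUnion_finset D fun c _ => measurableSet_ball]
        simp only [μ.addHaar_ball_of_pos _ δpos, Finset.sum_const, nsmul_eq_mul, mul_assoc]
      _ ≤ μ (Metric.ball (0 : E) ρ) := measure_mono A1
      _ = ENNReal.ofReal (ρ ^ Module.finrank ℝ E) * μ (Metric.ball 0 1) := by
        simp only [μ.addHaar_ball_of_pos _ ρpos]
  have J : (s.card : ENNReal) * ENNReal.ofReal (δ ^ Module.finrank ℝ E) ≤
      ENNReal.ofReal (ρ ^ Module.finrank ℝ E) := by
    rwa [ENNReal.mul_le_mul_iff_left (Metric.measure_ball_pos _ _ zero_lt_one).ne'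
      measure_ball_lt_top.ne] at I
  have K : (s.card : ℝ) * δ ^ Module.finrank ℝ E ≤ ρ ^ Module.finrank ℝ E := by
    simpa [ENNReal.toReal_mul, δpos.le, ρpos.le, ENNReal.toReal_ofReal, pow_nonneg] using
      ENNReal.toReal_le_of_le_ofReal (pow_nonneg ρpos.le _) J
  have e1 : 1 + 2 * A / l = ρ / δ := by simp only [ρ, δ]; field_simp; ring
  rw [e1, div_pow, le_div_iff₀ (by positivity)]
  exact K

lemma bad_measure {m n : ℕ} (hmn : n < m) (M : ℝ) (hM : 0 ≤ M) :
    ∃ C : ℝ, 0 ≤ C ∧ ∀ (R : ℝ) (δ : Fin n → ℝ), 0 ≤ R → (∀ i, 0 ≤ δ i) →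
    volume {e : Fin n → Fin m → ℝ | (∀ i k, |e i k| ≤ M) ∧ ∃ q : Fin m → ℤ, q ≠ 0 ∧
      (∀ k, |(q k : ℝ)| ≤ R) ∧ ∀ i, |∑ k, (q k : ℝ) * e i k| ≤ δ i} ≤
      ENNReal.ofReal (C * (R ^ (m - n) * ∏ i, δ i)) := by
  set D : ℝ := (2 * M) ^ (m - 1) * 2 with hD
  have hD0 : 0 ≤ D := by positivity
  refine ⟨m * (2 * 3 ^ (m - 1) * D ^ n), by positivity, ?_⟩
  intro R δ hR hδ
  let S : ℕ → Fin m → Finset (Fin m → ℤ) := fun r j =>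
    Fintype.piFinset (Function.update (fun _ => Finset.Icc (-(r : ℤ)) r) j {(r : ℤ), -(r : ℤ)})
  let Z : (Fin m → ℤ) → Set (Fin n → Fin m → ℝ) := fun q =>
    Set.pi Set.univ (fun i => {v : Fin m → ℝ | (∀ k, |v k| ≤ M) ∧ |∑ k, (q k : ℝ) * v k| ≤ δ i})
  have hsub : {e : Fin n → Fin m → ℝ | (∀ i k, |e i k| ≤ M) ∧ ∃ q : Fin m → ℤ, q ≠ 0 ∧
      (∀ k, |(q k : ℝ)| ≤ R) ∧ ∀ i, |∑ k, (q k : ℝ) * e i k| ≤ δ i} ⊆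
      ⋃ r ∈ Finset.Icc 1 ⌊R⌋₊, ⋃ j ∈ (Finset.univ : Finset (Fin m)), ⋃ q ∈ S r j, Z q := by
    rintro e ⟨h1, q, hq, h2, h3⟩
    have : Nonempty (Fin m) := ⟨⟨0, by omega⟩⟩
    obtain ⟨j, hj⟩ := Finite.exists_max (fun k => |q k|)
    simp only [Set.mem_iUnion]
    refine ⟨(q j).natAbs, ?_, j, Finset.mem_univ _, q, ?_, ?_⟩
    · rw [Finset.mem_Icc]
      constructor
      · by_contra hc
        apply hq
        have hz : (q j).natAbs = 0 := by omega
        ext k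
        have := hj k
        rw [Int.natAbs_eq_zero.1 hz] at this
        simpa using this
      · apply Nat.le_floor
        have := h2 j
        rw [Nat.cast_natAbs]
        push_cast
        exact this
    · rw [Fintype.mem_piFinset]
      intro k
      by_cases hk : k = j
      · subst hk
        simp only [Function.update_self, Finset.mem_insert, Finset.mem_singleton]
        have := Int.natAbs_eq (q k)
        exact this
      · rw [Function.update_of_ne hk, Finset.mem_Icc, ← abs_le]
        have := hj k
        simpa using this
    · intro i _
      exact ⟨h1 i, h3 i⟩
  have hZ : ∀ r ∈ Finset.Icc 1 ⌊R⌋₊, ∀ j, ∀ q ∈ S r j,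
      volume (Z q) ≤ ENNReal.ofReal (D ^ n * (∏ i, δ i) / (r : ℝ) ^ n) := by
    intro r hr j q hq
    have hr1 : 1 ≤ r := (Finset.mem_Icc.1 hr).1
    have hqj : |(q j : ℝ)| = r := by
      have := (Fintype.mem_piFinset.1 hq) j
      simp only [Function.update_self, Finset.mem_insert, Finset.mem_singleton] at this
      rcases this with h | h <;> rw [h] <;> simp
    have hqj0 : (q j : ℝ) ≠ 0 := by
      intro h
      rw [h] at hqj
      simp at hqj
      have : r = 0 := by exact_mod_cast hqj.symm
      omega
    simp only [Z]
    rw [volume_pi_pi]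
    calc _ ≤ ∏ i, ENNReal.ofReal ((2 * M) ^ (m - 1) * (2 * δ i) / |(q j : ℝ)|) :=
          Finset.prod_le_prod' (fun i _ => vol_strip (fun k => (q k : ℝ)) j hqj0 M (δ i) hM (hδ i))
      _ = ENNReal.ofReal (∏ i, ((2 * M) ^ (m - 1) * (2 * δ i) / |(q j : ℝ)|)) := by
          rw [ENNReal.ofReal_prod_of_nonneg]
          intro i _
          have := hδ i
          positivity
      _ = _ := by
          congr 1
          rw [hqj, Finset.prod_div_distrib]
          simp only [← mul_assoc]
          rw [Finset.prod_mul_distrib]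
          simp [hD]
  have hS : ∀ r ∈ Finset.Icc 1 ⌊R⌋₊, ∀ j, ((S r j).card : ℝ) ≤ 2 * 3 ^ (m - 1) * (r : ℝ) ^ (m - 1) := by
    intro r hr j
    have hr1 : 1 ≤ r := (Finset.mem_Icc.1 hr).1
    have : (S r j).card ≤ 2 * (3 * r) ^ (m - 1) := by
      simp only [S]
      rw [Fintype.card_piFinset, ← Finset.prod_erase_mul _ _ (Finset.mem_univ j), mul_comm]
      apply Nat.mul_le_mul
      · simp only [Function.update_self]
        exact Finset.card_le_two
      · rw [Finset.prod_congr rfl (g := fun _ => (2 * r + 1))]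
        · simp only [Finset.prod_const, Finset.card_erase_of_mem (Finset.mem_univ j),
            Finset.card_univ, Fintype.card_fin]
          exact Nat.pow_le_pow_left (by omega) _
        · intro x hx
          rw [Function.update_of_ne (Finset.ne_of_mem_erase hx), Int.card_Icc]
          omega
    calc ((S r j).card : ℝ) ≤ ((2 * (3 * r) ^ (m - 1) : ℕ) : ℝ) := by exact_mod_cast this
      _ = _ := by push_cast; rw [mul_pow]; ring
  have hP : 0 ≤ ∏ i, δ i := Finset.prod_nonneg (fun i _ => hδ i)
  calc _ ≤ _ := measure_mono hsub
    _ ≤ ∑ r ∈ Finset.Icc 1 ⌊R⌋₊, ∑ j : Fin m, ∑ q ∈ S r j, volume (Z q) := by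
        refine (measure_biUnion_finset_le _ _).trans (Finset.sum_le_sum fun r _ => ?_)
        refine (measure_biUnion_finset_le _ _).trans (Finset.sum_le_sum fun j _ => ?_)
        exact measure_biUnion_finset_le _ _
    _ ≤ ∑ r ∈ Finset.Icc 1 ⌊R⌋₊, ∑ j : Fin m, ∑ q ∈ S r j,
          ENNReal.ofReal (D ^ n * (∏ i, δ i) / (r : ℝ) ^ n) :=
        Finset.sum_le_sum fun r hr => Finset.sum_le_sum fun j _ => Finset.sum_le_sum fun q hq =>
          hZ r hr j q hq
    _ = ENNReal.ofReal (∑ r ∈ Finset.Icc 1 ⌊R⌋₊, ∑ j : Fin m, ∑ q ∈ S r j,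
          (D ^ n * (∏ i, δ i) / (r : ℝ) ^ n)) := by
        rw [ENNReal.ofReal_sum_of_nonneg (fun r _ => by positivity)]
        refine Finset.sum_congr rfl fun r _ => ?_
        rw [ENNReal.ofReal_sum_of_nonneg (fun r _ => by positivity)]
        refine Finset.sum_congr rfl fun j _ => ?_
        rw [ENNReal.ofReal_sum_of_nonneg (fun r _ => by positivity)]
    _ ≤ _ := by
        apply ENNReal.ofReal_le_ofReal
        calc _ ≤ ∑ r ∈ Finset.Icc 1 ⌊R⌋₊, ∑ j : Fin m,
              (2 * 3 ^ (m - 1) * D ^ n * (∏ i, δ i)) * R ^ (m - 1 - n) := by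
              refine Finset.sum_le_sum fun r hr => Finset.sum_le_sum fun j _ => ?_
              have hr1 : 1 ≤ r := (Finset.mem_Icc.1 hr).1
              have hr0 : (0 : ℝ) < r := by exact_mod_cast hr1
              have hrR : (r : ℝ) ≤ R := (Nat.le_floor_iff hR).1 (Finset.mem_Icc.1 hr).2
              rw [Finset.sum_const, nsmul_eq_mul]
              have e1 : (r : ℝ) ^ (m - 1) = r ^ (m - 1 - n) * r ^ n := by
                rw [← pow_add]; congr 1; omega
              calc _ ≤ (2 * 3 ^ (m - 1) * (r : ℝ) ^ (m - 1)) * (D ^ n * (∏ i, δ i) / (r : ℝ) ^ n) := by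
                    gcongr
                    exact hS r hr j
                _ = (2 * 3 ^ (m - 1) * D ^ n * (∏ i, δ i)) * (r : ℝ) ^ (m - 1 - n) := by
                    rw [e1]; field_simp
                _ ≤ _ := by gcongr
          _ = (⌊R⌋₊ : ℝ) * (m * ((2 * 3 ^ (m - 1) * D ^ n * (∏ i, δ i)) * R ^ (m - 1 - n))) := by
              simp
          _ ≤ R * (m * ((2 * 3 ^ (m - 1) * D ^ n * (∏ i, δ i)) * R ^ (m - 1 - n))) := by
              gcongr
              exact Nat.floor_le hR
          _ = _ := by
              have : R ^ (m - n) = R ^ (m - 1 - n) * R := by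
                rw [← pow_succ]; congr 1; omega
              rw [this]; ring

lemma borel_cantelli_bad {m n : ℕ} (hmn : n < m) (R : ℕ → ℝ) (δ : ℕ → Fin n → ℝ)
    (hR : ∀ k, 0 ≤ R k) (hδ : ∀ k i, 0 ≤ δ k i)
    (hsum : Summable (fun k => R k ^ (m - n) * ∏ i, δ k i)) :
    ∀ᵐ e ∂(volume : Measure (Fin n → Fin m → ℝ)), ∀ᶠ k in atTop, ∀ q : Fin m → ℤ, q ≠ 0 →
      (∀ l, |(q l : ℝ)| ≤ R k) → ∃ i, δ k i < |∑ l, (q l : ℝ) * e i l| := by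
  have key : ∀ M : ℕ, ∀ᵐ e ∂(volume : Measure (Fin n → Fin m → ℝ)), ∀ᶠ k in atTop,
      ¬ ((∀ i l, |e i l| ≤ (M : ℝ)) ∧ ∃ q : Fin m → ℤ, q ≠ 0 ∧
      (∀ l, |(q l : ℝ)| ≤ R k) ∧ ∀ i, |∑ l, (q l : ℝ) * e i l| ≤ δ k i) := by
    intro M
    obtain ⟨C, hC, h⟩ := bad_measure hmn (M : ℝ) (Nat.cast_nonneg M)
    have hs : ∑' k, volume {e : Fin n → Fin m → ℝ | (∀ i l, |e i l| ≤ (M : ℝ)) ∧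
        ∃ q : Fin m → ℤ, q ≠ 0 ∧ (∀ l, |(q l : ℝ)| ≤ R k) ∧
        ∀ i, |∑ l, (q l : ℝ) * e i l| ≤ δ k i} ≠ ⊤ := by
      refine ne_top_of_le_ne_top ?_ (ENNReal.tsum_le_tsum fun k => h (R k) (δ k) (hR k) (hδ k))
      exact (hsum.mul_left C).tsum_ofReal_ne_top
    exact ae_eventually_notMem hs
  filter_upwards [ae_all_iff.2 key] with e he
  obtain ⟨M, hM⟩ := exists_nat_ge ‖e‖
  filter_upwards [he M] with k hk q hq hqR
  by_contra hcon
  push Not at hcon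
  exact hk ⟨fun i l => ((norm_le_pi_norm (e i) l).trans (norm_le_pi_norm e i)).trans hM,
    q, hq, hqR, hcon⟩

lemma exists_indep {m n : ℕ} (hm : 0 < m) (e : Fin n → Fin m → ℝ) (R A : ℕ) (δ : Fin n → ℝ)
    (E l : ℝ) (hA : 1 ≤ A) (hR : 1 ≤ R) (hδ : ∀ i, 0 < δ i) (hδR : ∀ i, δ i ≤ R)
    (hE0 : 0 ≤ E) (hE : ∀ i k, |e i k| ≤ E) (hl : 0 < l) (hl1 : l ≤ 1)
    (hsep : ∀ q : Fin m → ℤ, q ≠ 0 → (∀ k, |(q k : ℝ)| ≤ l * R) →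
      ∃ i, l * δ i < |∑ k, (q k : ℝ) * e i k|)
    (hbig : (∏ i, ((2 * m * E + 3) * R / δ i)) * (3 * A / l) ^ (m - 1) < ((A : ℝ) * R) ^ m) :
    ∃ q : Fin m → (Fin m → ℤ), LinearIndependent ℝ (fun j => fun i => ((q j i : ℝ))) ∧
      ∀ j, (∀ k, |(q j k : ℝ)| ≤ A * R) ∧ ∀ i, |∑ k, (q j k : ℝ) * e i k| ≤ A * δ i := by
  have hA0 : (0 : ℝ) < A := by exact_mod_cast hA
  have hA1 : (1 : ℝ) ≤ A := by exact_mod_cast hA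
  have hR0 : (0 : ℝ) < R := by exact_mod_cast hR
  let G : Set (Fin m → ℝ) := {x | ∃ q : Fin m → ℤ, (x = fun k => (q k : ℝ)) ∧
    (∀ k, |(q k : ℝ)| ≤ A * R) ∧ ∀ i, |∑ k, (q k : ℝ) * e i k| ≤ A * δ i}
  by_cases hfr : Module.finrank ℝ (Submodule.span ℝ G) = m
  · obtain ⟨f, hf, -, hli⟩ := Submodule.exists_fun_fin_finrank_span_eq ℝ G
    choose q hq1 hq2 hq3 using hf
    let c : Fin m → Fin (Module.finrank ℝ (Submodule.span ℝ G)) := Fin.cast hfr.symm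
    refine ⟨fun j => q (c j), ?_, fun j => ⟨hq2 _, hq3 _⟩⟩
    have := hli.comp c (Fin.cast_injective _)
    have heq : (fun j => fun i => ((q (c j) i : ℝ))) = f ∘ c := funext fun j => (hq1 (c j)).symm
    rw [heq]
    exact this
  exfalso
  have hfr' : Module.finrank ℝ (Submodule.span ℝ G) ≤ m - 1 := by
    have := Submodule.finrank_le (Submodule.span ℝ G)
    simp at this
    omega
  -- pigeonhole
  let s : Finset (Fin m → ℤ) := Fintype.piFinset (fun _ => Finset.Ico (0 : ℤ) (A * R : ℕ))
  let Mi : Fin n → ℤ := fun i => ⌈m * E * R / δ i⌉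
  let t : Finset (Fin n → ℤ) := Fintype.piFinset (fun i => Finset.Icc (-(Mi i)) (Mi i))
  let g : (Fin m → ℤ) → (Fin n → ℤ) := fun q i => ⌊(∑ k, (q k : ℝ) * e i k) / (A * δ i)⌋
  have hmem : ∀ q ∈ s, ∀ k, 0 ≤ (q k : ℝ) ∧ (q k : ℝ) ≤ A * R := by
    intro q hq k
    have := Finset.mem_Ico.1 ((Fintype.mem_piFinset.1 hq) k)
    refine ⟨by exact_mod_cast this.1, ?_⟩
    have h2 := this.2.le
    have : ((q k : ℤ) : ℝ) ≤ (((A * R : ℕ) : ℤ) : ℝ) := by exact_mod_cast h2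
    simpa using this
  have hmaps : ∀ q ∈ s, g q ∈ t := by
    intro q hq
    rw [Fintype.mem_piFinset]
    intro i
    have h1 : |∑ k, (q k : ℝ) * e i k| ≤ m * E * R * A := by
      calc _ ≤ ∑ k, |(q k : ℝ) * e i k| := Finset.abs_sum_le_sum_abs _ _
        _ ≤ ∑ k : Fin m, (A * R) * E := by
            refine Finset.sum_le_sum fun k _ => ?_
            rw [abs_mul]
            obtain ⟨h0, h1⟩ := hmem q hq k
            rw [abs_of_nonneg h0]
            exact mul_le_mul h1 (hE i k) (abs_nonneg _) (by positivity)
        _ = _ := by simp; ring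
    have h2 : |(∑ k, (q k : ℝ) * e i k) / (A * δ i)| ≤ m * E * R / δ i := by
      have := hδ i
      rw [abs_div, abs_of_pos (by positivity : 0 < A * δ i), div_le_div_iff₀ (by positivity) this]
      nlinarith [mul_le_mul_of_nonneg_right h1 this.le]
    have h3 := abs_le.1 (h2.trans (Int.le_ceil _))
    rw [Finset.mem_Icc]
    constructor
    · apply Int.le_floor.2
      push_cast
      exact h3.1
    · have := (Int.floor_le ((∑ k, (q k : ℝ) * e i k) / (A * δ i))).trans h3.2
      exact_mod_cast this
  have hcards : (s.card : ℝ) = ((A : ℝ) * R) ^ m := by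
    simp only [s, Fintype.card_piFinset, Int.card_Ico, sub_zero, Int.toNat_natCast]
    simp
  have hcardt : (t.card : ℝ) ≤ ∏ i, ((2 * m * E + 3) * R / δ i) := by
    simp only [t, Fintype.card_piFinset]
    push_cast
    refine Finset.prod_le_prod (fun _ _ => by positivity) fun i _ => ?_
    have hd := hδ i
    have hM0 : 0 ≤ Mi i := Int.ceil_nonneg (by positivity)
    have h1 : (Mi i : ℝ) < m * E * R / δ i + 1 := Int.ceil_lt_add_one _
    rw [Int.card_Icc]
    have h2 : (((Mi i + 1 - -Mi i).toNat : ℕ) : ℝ) = 2 * Mi i + 1 := by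
      have : (((Mi i + 1 - -Mi i).toNat : ℕ) : ℤ) = 2 * Mi i + 1 := by omega
      exact_mod_cast this
    rw [h2]
    have h3 : 1 ≤ R / δ i := (one_le_div hd).2 (hδR i)
    have h4 : (2 * m * E + 3) * R / δ i = 2 * (m * E * R / δ i) + 3 * (R / δ i) := by ring
    rw [h4]; linarith
  obtain ⟨y, -, hy⟩ := Finset.exists_lt_card_fiber_of_nsmul_lt_card_of_maps_to
    (s := s) (t := t) (f := g) (b := (3 * A / l : ℝ) ^ (m - 1)) hmaps (by
      rw [nsmul_eq_mul, hcards]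
      refine lt_of_le_of_lt ?_ hbig
      gcongr)
  set P : Finset (Fin m → ℤ) := {x ∈ s | g x = y} with hP
  have hPpos : 0 < P.card := by
    have : (0 : ℝ) < P.card := lt_of_le_of_lt (by positivity) hy
    exact_mod_cast this
  obtain ⟨p0, hp0⟩ := Finset.card_pos.1 hPpos
  have hdiff : ∀ p ∈ P, ∀ p' ∈ P, (fun k => ((p k : ℝ) - (p' k : ℝ))) ∈ G := by
    intro p hp p' hp'
    obtain ⟨hps, hpy⟩ := Finset.mem_filter.1 hp
    obtain ⟨hps', hpy'⟩ := Finset.mem_filter.1 hp'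
    refine ⟨p - p', ?_, ?_, ?_⟩
    · ext k; simp
    · intro k
      have h1 := hmem p hps k
      have h2 := hmem p' hps' k
      simp only [Pi.sub_apply, Int.cast_sub]
      rw [abs_le]; constructor <;> linarith [h1.1, h1.2, h2.1, h2.2]
    · intro i
      have hd := hδ i
      have hg : g p i = g p' i := by rw [hpy, hpy']
      have := (Int.abs_sub_lt_one_of_floor_eq_floor hg).le
      rw [← sub_div, abs_div, abs_of_pos (by positivity : 0 < A * δ i),
        div_le_one (by positivity), ← Finset.sum_sub_distrib] at this
      simpa [sub_mul] using this
  let T : (Fin m → ℝ) →ₗ[ℝ] (Fin m → ℝ) × (Fin n → ℝ) :=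
    { toFun := fun x => (fun k => x k / R, fun i => (∑ k, x k * e i k) / δ i)
      map_add' := by
        intro x z
        ext k
        · simp [add_div]
        · simp [add_mul, Finset.sum_add_distrib, add_div]
      map_smul' := by
        intro c x
        ext k
        · simp [mul_div_assoc]
        · simp only [Pi.smul_apply, smul_eq_mul, RingHom.id_apply, Prod.smul_snd]
          rw [← mul_div_assoc, Finset.mul_sum]
          simp only [mul_assoc] }
  let W := (Submodule.span ℝ G).map T
  have hW : Module.finrank ℝ W ≤ m - 1 := (Submodule.finrank_map_le T _).trans hfr'
  have hmemW : ∀ p : P, T (fun k => ((p.1 k : ℝ) - (p0 k : ℝ))) ∈ W := fun p =>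
    Submodule.mem_map_of_mem (Submodule.subset_span (hdiff p.1 p.2 p0 hp0))
  let f : P → W := fun p => ⟨_, hmemW p⟩
  have hpack := packing (Finset.univ : Finset P) f (A : ℝ) l hA0.le hl ?_ ?_
  · simp only [Finset.card_univ, Fintype.card_coe] at hpack
    have h1 : 1 + 2 * A / l ≤ 3 * A / l := by
      have : 1 ≤ A / l := (one_le_div hl).2 (hl1.trans hA1)
      have e1 : 3 * A / l = 3 * (A / l) := by ring
      have e2 : 2 * A / l = 2 * (A / l) := by ring
      rw [e1, e2]; linarith
    have h2 : 1 ≤ 1 + 2 * A / l := by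
      have : 0 ≤ 2 * A / l := by positivity
      linarith
    have h3 : (1 + 2 * A / l) ^ Module.finrank ℝ W ≤ (3 * A / l) ^ (m - 1) :=
      (pow_le_pow_right₀ h2 hW).trans (pow_le_pow_left₀ (by linarith) h1 _)
    linarith
  · rintro ⟨p, hp⟩ -
    obtain ⟨q, hq1, hq2, hq3⟩ := hdiff p hp p0 hp0
    have : f ⟨p, hp⟩ = ⟨T (fun k => (q k : ℝ)), by rw [← hq1]; exact hmemW ⟨p, hp⟩⟩ := by
      apply Subtype.ext
      simp only [f, hq1]
    rw [this]
    rw [Submodule.coe_norm]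
    refine max_le ?_ ?_
    · refine (pi_norm_le_iff_of_nonneg hA0.le).2 fun k => ?_
      change ‖(q k : ℝ) / R‖ ≤ A
      rw [Real.norm_eq_abs, abs_div, abs_of_pos hR0, div_le_iff₀ hR0]
      exact hq2 k
    · refine (pi_norm_le_iff_of_nonneg hA0.le).2 fun i => ?_
      change ‖(∑ k, (q k : ℝ) * e i k) / δ i‖ ≤ A
      rw [Real.norm_eq_abs, abs_div, abs_of_pos (hδ i), div_le_iff₀ (hδ i)]
      exact hq3 i
  · rintro ⟨p, hp⟩ - ⟨p', hp'⟩ - hne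
    by_contra! hlt
    have hne' : p - p' ≠ 0 := by
      intro h
      apply hne
      simpa [sub_eq_zero] using h
    have hfd : ((f ⟨p, hp⟩ - f ⟨p', hp'⟩ : W) : (Fin m → ℝ) × (Fin n → ℝ)) =
        T (fun k => (((p - p') k : ℤ) : ℝ)) := by
      simp only [f, Submodule.coe_sub]
      rw [← map_sub]
      congr 1
      ext k
      simp
    rw [Submodule.coe_norm, hfd] at hlt
    have hlt1 := ((le_max_left _ _).trans_lt hlt).le
    have hlt2 := ((le_max_right _ _).trans_lt hlt).le
    obtain ⟨i, hi⟩ := hsep (p - p') hne' (by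
      intro k
      have := (pi_norm_le_iff_of_nonneg hl.le).1 hlt1 k
      change ‖(((p - p') k : ℤ) : ℝ) / R‖ ≤ l at this
      rwa [Real.norm_eq_abs, abs_div, abs_of_pos hR0, div_le_iff₀ hR0] at this)
    have := (pi_norm_le_iff_of_nonneg hl.le).1 hlt2 i
    change ‖(∑ k, (((p - p') k : ℤ) : ℝ) * e i k) / δ i‖ ≤ l at this
    rw [Real.norm_eq_abs, abs_div, abs_of_pos (hδ i), div_le_iff₀ (hδ i)] at this
    linarith

lemma summable_aux (f : ℕ → ℝ) (C s : ℝ) (hs : 1 < s)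
    (h : ∀ k : ℕ, 1 ≤ k → f k = C * (k : ℝ) ^ (-s)) : Summable f := by
  have h0 : Summable (fun k : ℕ => |C| * (k : ℝ) ^ (-s)) :=
    (Real.summable_nat_rpow.2 (by linarith)).mul_left |C|
  refine h0.of_norm_bounded_eventually_nat ?_
  filter_upwards [eventually_ge_atTop 1] with k hk
  rw [h k hk, norm_mul, Real.norm_eq_abs, Real.norm_eq_abs, abs_of_nonneg (Real.rpow_nonneg (Nat.cast_nonneg k) (-s))]

lemma dyadic {m n : ℕ} (hn : 0 < n) (hmn : n < m) (τ β : Fin n → ℝ) (s : ℝ) (hs : 1 < s)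
    (hτ : ∀ i, 0 < τ i) (hτsum : ∑ i, τ i = (m : ℝ) - n)
    (hβ : ∑ i, β i = s * ((m : ℝ) - 1)) :
    ∀ᵐ e ∂(volume : Measure (Fin n → Fin m → ℝ)), ∃ A : ℝ, 0 < A ∧ ∀ᶠ k : ℕ in atTop,
      ∃ q : Fin m → (Fin m → ℤ), LinearIndependent ℝ (fun j => fun i => ((q j i : ℝ))) ∧
        ∀ j, (∀ l, |(q j l : ℝ)| ≤ A * 2 ^ k) ∧ ∀ i,
          ((2 : ℝ) ^ k) ^ (-(τ i)) * (k : ℝ) ^ (β i - s * m) ≤ |∑ l, (q j l : ℝ) * e i l| ∧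
          |∑ l, (q j l : ℝ) * e i l| ≤ A * (((2 : ℝ) ^ k) ^ (-(τ i)) * (k : ℝ) ^ (β i)) := by
  let d : ℕ → Fin n → ℝ := fun k i => ((2 : ℝ) ^ k) ^ (-(τ i)) * (k : ℝ) ^ (β i)
  have hd0 : ∀ k i, 0 ≤ d k i := fun k i => by positivity
  have hdpos : ∀ k, 1 ≤ k → ∀ i, 0 < d k i := fun k hk i => by
    have : (0 : ℝ) < k := by exact_mod_cast hk
    positivity
  have hmn' : (((m - n : ℕ) : ℕ) : ℝ) = (m : ℝ) - n := by rw [Nat.cast_sub hmn.le]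
  have hprod : ∀ k : ℕ, 1 ≤ k → ((2 : ℝ) ^ k) ^ (m - n) * ∏ i, d k i = (k : ℝ) ^ (s * ((m : ℝ) - 1)) := by
    intro k hk
    have hk0 : (0 : ℝ) < k := by exact_mod_cast hk
    have h2 : (0 : ℝ) < 2 ^ k := by positivity
    simp only [d]
    rw [Finset.prod_mul_distrib, ← Real.rpow_sum_of_pos h2, ← Real.rpow_sum_of_pos hk0, hβ,
      Finset.sum_neg_distrib, hτsum, ← mul_assoc, ← Real.rpow_natCast _ (m - n), hmn',
      ← Real.rpow_add h2]
    simp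
  -- first Borel-Cantelli
  have bc1 := borel_cantelli_bad hmn (fun k => (k : ℝ) ^ (-s) * 2 ^ k)
    (fun k i => (k : ℝ) ^ (-s) * d k i) (fun k => by positivity)
    (fun k i => mul_nonneg (by positivity) (hd0 k i)) (by
      refine summable_aux _ 1 s hs fun k hk => ?_
      have hk0 : (0 : ℝ) < k := by exact_mod_cast hk
      have hm : ((k : ℝ) ^ (-s)) ^ (m - n) * ((k : ℝ) ^ (-s)) ^ n = (k : ℝ) ^ (-s * m) := by
        rw [← pow_add, Nat.sub_add_cancel hmn.le, Real.rpow_mul hk0.le, Real.rpow_natCast]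
      rw [Finset.prod_mul_distrib, Finset.prod_const, Finset.card_univ, Fintype.card_fin, mul_pow]
      calc _ = (((k : ℝ) ^ (-s)) ^ (m - n) * ((k : ℝ) ^ (-s)) ^ n) *
              (((2 : ℝ) ^ k) ^ (m - n) * ∏ i, d k i) := by ring
        _ = _ := by
            rw [hm, hprod k hk, ← Real.rpow_add hk0, one_mul]
            congr 1; ring)
  have bc2 : ∀ A : ℕ, ∀ i0 : Fin n, ∀ᵐ e ∂(volume : Measure (Fin n → Fin m → ℝ)),
      ∀ᶠ k : ℕ in atTop, ∀ q : Fin m → ℤ, q ≠ 0 →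
      (∀ l, |(q l : ℝ)| ≤ (A : ℝ) * 2 ^ k) → ∃ i, (if i = i0 then (k : ℝ) ^ (-s * m) else A) * d k i
        < |∑ l, (q l : ℝ) * e i l| := by
    intro A i0
    refine borel_cantelli_bad hmn (fun k => (A : ℝ) * 2 ^ k)
      (fun k i => (if i = i0 then (k : ℝ) ^ (-s * m) else A) * d k i) (fun k => by positivity)
      (fun k i => mul_nonneg (by split_ifs <;> positivity) (hd0 k i)) ?_
    refine summable_aux _ ((A : ℝ) ^ (m - n) * A ^ (n - 1)) s hs fun k hk => ?_
    have hk0 : (0 : ℝ) < k := by exact_mod_cast hk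
    have hite : ∏ i : Fin n, (if i = i0 then (k : ℝ) ^ (-s * m) else A) =
        (A : ℝ) ^ (n - 1) * (k : ℝ) ^ (-s * m) := by
      rw [← Finset.prod_erase_mul _ _ (Finset.mem_univ i0)]
      congr 1
      · rw [Finset.prod_congr rfl (g := fun _ => (A : ℝ))]
        · simp
        · intro x hx
          rw [if_neg (Finset.ne_of_mem_erase hx)]
      · simp
    rw [Finset.prod_mul_distrib, hite, mul_pow]
    calc _ = ((A : ℝ) ^ (m - n) * A ^ (n - 1)) * ((k : ℝ) ^ (-s * m) *
              (((2 : ℝ) ^ k) ^ (m - n) * ∏ i, d k i)) := by ring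
      _ = _ := by
            rw [hprod k hk, ← Real.rpow_add hk0]
            congr 2; ring
  have hsmall : ∀ i, ∀ᶠ k : ℕ in atTop, d k i ≤ 1 := by
    intro i
    have h1 := (tendsto_rpow_mul_exp_neg_mul_atTop_nhds_zero (β i) (τ i * Real.log 2)
      (mul_pos (hτ i) (Real.log_pos (by norm_num)))).comp (tendsto_natCast_atTop_atTop (R := ℝ))
    filter_upwards [h1.eventually (eventually_le_nhds (zero_lt_one))] with k hk
    refine le_trans (le_of_eq ?_) hk
    simp only [d, Function.comp]
    rw [mul_comm]
    congr 1
    rw [Real.rpow_def_of_pos (by positivity), Real.log_pow]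
    congr 1; ring
  filter_upwards [bc1, ae_all_iff.2 fun A => ae_all_iff.2 (bc2 A)] with e he1 he2
  set B : ℝ := 2 * m * ‖e‖ + 3 with hB
  have hB0 : 0 < B := by positivity
  obtain ⟨A, hA⟩ := exists_nat_gt (3 ^ (m - 1) * B ^ n + 1)
  have hA1 : (1 : ℝ) < A := lt_of_le_of_lt (by
    have : 0 ≤ 3 ^ (m - 1) * B ^ n := by positivity
    linarith) hA
  have hA0 : (0 : ℝ) < A := by linarith
  refine ⟨A, hA0, ?_⟩
  filter_upwards [he1, eventually_all.2 (he2 A), eventually_all.2 hsmall, eventually_ge_atTop 1]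
    with k h1 h2 h3 hk
  have hk0 : (0 : ℝ) < k := by exact_mod_cast hk
  have hk1 : (1 : ℝ) ≤ k := by exact_mod_cast hk
  have h2k : (1 : ℝ) ≤ 2 ^ k := one_le_pow₀ (by norm_num)
  have hcast : ((2 ^ k : ℕ) : ℝ) = 2 ^ k := by push_cast; rfl
  obtain ⟨q, hq1, hq2⟩ := exists_indep (by omega) e (2 ^ k) A (d k) ‖e‖ ((k : ℝ) ^ (-s))
    (by exact_mod_cast hA1.le) Nat.one_le_two_pow (hdpos k hk)
    (fun i => by rw [hcast]; exact (h3 i).trans h2k) (norm_nonneg e)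
    (fun i l => (norm_le_pi_norm (e i) l).trans (norm_le_pi_norm e i))
    (by positivity) (Real.rpow_le_one_of_one_le_of_nonpos hk1 (by linarith))
    (fun q hq0 hqR => h1 q hq0 (by rw [hcast] at hqR; exact hqR)) (by
      rw [hcast, ← hB]
      have hp := hprod k hk
      have hpp : 0 < ∏ i, d k i := Finset.prod_pos fun i _ => hdpos k hk i
      have hks : ((k : ℝ) ^ (-s))⁻¹ ^ (m - 1) = (k : ℝ) ^ (s * ((m : ℝ) - 1)) := by
        rw [← Real.rpow_neg hk0.le, neg_neg, Real.rpow_mul hk0.le, ← Real.rpow_natCast _ (m - 1),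
          Nat.cast_sub (by omega)]
        simp
      rw [Finset.prod_div_distrib, Finset.prod_const, Finset.card_univ, Fintype.card_fin,
        div_eq_mul_inv (3 * (A : ℝ)), mul_pow _ (_)⁻¹, hks, ← hp]
      have e1 : ((2 : ℝ) ^ k) ^ m = ((2 : ℝ) ^ k) ^ (m - n) * ((2 : ℝ) ^ k) ^ n := by
        rw [← pow_add, Nat.sub_add_cancel hmn.le]
      have e2 : (A : ℝ) ^ m = A ^ (m - 1) * A := by
        rw [← pow_succ]; congr 1; omega
      calc _ = (3 ^ (m - 1) * B ^ n) * (A ^ (m - 1) * (((2 : ℝ) ^ k) ^ (m - n) * ((2 : ℝ) ^ k) ^ n)) := by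
            rw [mul_pow, mul_pow]; field_simp
        _ < A * (A ^ (m - 1) * (((2 : ℝ) ^ k) ^ (m - n) * ((2 : ℝ) ^ k) ^ n)) := by
            apply mul_lt_mul_of_pos_right _ (by positivity)
            linarith
        _ = _ := by rw [mul_pow, e1, e2]; ring)
  rw [hcast] at hq2
  refine ⟨q, hq1, fun j => ⟨(hq2 j).1, fun i => ⟨?_, (hq2 j).2 i⟩⟩⟩
  have hqj : q j ≠ 0 := by
    intro h
    apply hq1.ne_zero j
    ext l
    simp [h]
  obtain ⟨i', hi'⟩ := h2 i (q j) hqj (hq2 j).1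
  have : i' = i := by
    by_contra hne
    rw [if_neg hne] at hi'
    exact absurd ((hq2 j).2 i') (not_le.2 hi')
  subst this
  rw [if_pos rfl] at hi'
  refine le_trans (le_of_eq ?_) hi'.le
  simp only [d]
  rw [sub_eq_add_neg, Real.rpow_add hk0]
  rw [neg_mul]; ring

lemma rpow_cmp (u v x γ : ℝ) (hu : 0 < u) (h1 : u ≤ x) (h2 : x ≤ v) :
    min (u ^ γ) (v ^ γ) ≤ x ^ γ ∧ x ^ γ ≤ max (u ^ γ) (v ^ γ) := by
  have hx : 0 < x := hu.trans_le h1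
  rcases le_total 0 γ with h | h
  · exact ⟨(min_le_left _ _).trans (Real.rpow_le_rpow hu.le h1 h),
      (Real.rpow_le_rpow hx.le h2 h).trans (le_max_right _ _)⟩
  · exact ⟨(min_le_right _ _).trans (Real.rpow_le_rpow_of_nonpos hx h2 h),
      (Real.rpow_le_rpow_of_nonpos hu h1 h).trans (le_max_left _ _)⟩

/-- Supremum norm of an integer vector, as a real number. -/
noncomputable def supZ {k : ℕ} (q : Fin k → ℤ) : ℝ := ‖(fun i => (q i : ℝ))‖

theorem stmt6 (m n : ℕ) (hn : 0 < n) (hmn : n < m)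
    (τ β : Fin n → ℝ) (ε : ℝ)
    (hτ : ∀ i, 0 < τ i) (hε : 0 < ε)
    (hτsum : ∑ i, τ i ≤ (m : ℝ) - n)
    (hβ : ∑ i, β i = (1 + ε) * ((m : ℝ) - 1)) :
    ∀ᵐ e ∂(volume : Measure (Fin n → Fin m → ℝ)),
      ∃ c > (0:ℝ), ∃ C > (0:ℝ), ∃ Q₀ : ℕ, ∀ Q : ℕ, Q₀ ≤ Q →
        ∃ q : Fin m → (Fin m → ℤ),
          LinearIndependent ℝ (fun j => fun i => ((q j i : ℝ))) ∧
          ∀ j, supZ (q j) ≤ C * Q ∧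
            ∀ i, c * (Q : ℝ) ^ (-(τ i)) * Real.log Q ^ (β i - (1 + ε) * m)
                  ≤ |∑ k, (q j k : ℝ) * e i k| ∧
              |∑ k, (q j k : ℝ) * e i k|
                  ≤ C * (Q : ℝ) ^ (-(τ i)) * Real.log Q ^ (β i) := by
  have hne : (Finset.univ : Finset (Fin n)).Nonempty := ⟨⟨0, hn⟩, Finset.mem_univ _⟩
  have hmn0 : (0 : ℝ) < (m : ℝ) - n := by
    have : (n : ℝ) < m := by exact_mod_cast hmn
    linarith
  have hS : 0 < ∑ i, τ i := Finset.sum_pos (fun i _ => hτ i) hne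
  set θ : ℝ := (∑ i, τ i) / ((m : ℝ) - n) with hθ
  have hθ0 : 0 < θ := div_pos hS hmn0
  have hθ1 : θ ≤ 1 := (div_le_one hmn0).2 hτsum
  have hlog2 : 0 < Real.log 2 := Real.log_pos (by norm_num)
  set a : ℝ := θ / Real.log 2 with ha
  have ha0 : 0 < a := div_pos hθ0 hlog2
  have hmain := dyadic hn hmn (fun i => τ i / θ) β (1 + ε) (by linarith)
    (fun i => div_pos (hτ i) hθ0) (by
      rw [← Finset.sum_div, hθ]; field_simp) hβ
  filter_upwards [hmain] with e he
  obtain ⟨A, hA, hk⟩ := he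
  set cf : Fin n → ℝ := fun i =>
    min ((a / 2) ^ (β i - (1 + ε) * m)) (a ^ (β i - (1 + ε) * m)) with hcf
  set Cf : Fin n → ℝ := fun i =>
    A * (2 ^ (τ i / θ) * max ((a / 2) ^ (β i)) (a ^ (β i))) with hCf
  have hCf0 : ∀ i, 0 < Cf i := fun i => by
    have : 0 < max ((a / 2) ^ (β i)) (a ^ (β i)) := lt_max_of_lt_right (by positivity)
    positivity
  refine ⟨Finset.univ.inf' hne cf, ?_, A + ∑ i, Cf i, ?_, ?_⟩
  · rw [gt_iff_lt, Finset.lt_inf'_iff]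
    intro i _
    exact lt_min (by positivity) (by positivity)
  · have := Finset.sum_nonneg (fun i (_ : i ∈ Finset.univ) => (hCf0 i).le)
    linarith
  have ht1 : Tendsto (fun Q : ℕ => a * Real.log Q) atTop atTop :=
    (Real.tendsto_log_atTop.comp (tendsto_natCast_atTop_atTop (R := ℝ))).const_mul_atTop ha0
  have ht : Tendsto (fun Q : ℕ => ⌊a * Real.log Q⌋₊) atTop atTop :=
    tendsto_nat_floor_atTop.comp ht1
  rw [← eventually_atTop]
  filter_upwards [ht.eventually hk, ht.eventually (eventually_ge_atTop 1), eventually_ge_atTop 2]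
    with Q hQ hQ1 hQ2
  obtain ⟨q, hq1, hq2⟩ := hQ
  refine ⟨q, hq1, ?_⟩
  set k : ℕ := ⌊a * Real.log Q⌋₊ with hkdef
  have hQr : (2 : ℝ) ≤ Q := by exact_mod_cast hQ2
  have hQ0 : (0 : ℝ) < Q := by linarith
  have hL : 0 < Real.log Q := Real.log_pos (by linarith)
  set L : ℝ := Real.log Q with hLdef
  have hk1 : (1 : ℝ) ≤ k := by exact_mod_cast hQ1
  have hkle : (k : ℝ) ≤ a * L := Nat.floor_le (by positivity)
  have hklt : a * L < k + 1 := Nat.lt_floor_add_one _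
  have haL : a * Real.log 2 = θ := by rw [ha]; field_simp
  have hkx1 : a / 2 ≤ k / L := by rw [le_div_iff₀ hL]; linarith
  have hkx2 : k / L ≤ a := by rw [div_le_iff₀ hL]; exact hkle
  have hkpow : ∀ γ : ℝ, (k : ℝ) ^ γ = (k / L) ^ γ * L ^ γ := by
    intro γ
    rw [← Real.mul_rpow (by positivity) hL.le, div_mul_cancel₀ _ hL.ne']
  have hklog1 : k * Real.log 2 ≤ θ * L := by
    calc k * Real.log 2 ≤ (a * L) * Real.log 2 := by gcongr
      _ = θ * L := by rw [← haL]; ring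
  have hklog2 : θ * L ≤ k * Real.log 2 + Real.log 2 := by
    calc θ * L = (a * L) * Real.log 2 := by rw [← haL]; ring
      _ ≤ (k + 1) * Real.log 2 := by gcongr
      _ = _ := by ring
  have h2kQ : (2 : ℝ) ^ k ≤ Q := by
    rw [← Real.log_le_log_iff (by positivity) hQ0, Real.log_pow]
    exact hklog1.trans (mul_le_of_le_one_left hL.le hθ1)
  have hpow1 : ∀ i, (Q : ℝ) ^ (-(τ i)) ≤ ((2 : ℝ) ^ k) ^ (-(τ i / θ)) := by
    intro i
    rw [Real.rpow_def_of_pos hQ0, Real.rpow_def_of_pos (by positivity), Real.log_pow]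
    apply Real.exp_le_exp.2
    have h0 : 0 ≤ τ i / θ := (div_pos (hτ i) hθ0).le
    have := mul_le_mul_of_nonneg_left hklog1 h0
    have e1 : τ i / θ * (θ * L) = τ i * L := by field_simp
    rw [e1] at this
    linarith
  have hpow2 : ∀ i, ((2 : ℝ) ^ k) ^ (-(τ i / θ)) ≤ 2 ^ (τ i / θ) * (Q : ℝ) ^ (-(τ i)) := by
    intro i
    rw [Real.rpow_def_of_pos hQ0, Real.rpow_def_of_pos (by positivity), Real.log_pow,
      Real.rpow_def_of_pos (by norm_num), ← Real.exp_add]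
    apply Real.exp_le_exp.2
    have h0 : 0 ≤ τ i / θ := (div_pos (hτ i) hθ0).le
    have := mul_le_mul_of_nonneg_left hklog2 h0
    have e1 : τ i / θ * (θ * L) = τ i * L := by field_simp
    rw [e1] at this
    linarith
  intro j
  have hCsum : ∀ i, Cf i ≤ ∑ i, Cf i := fun i =>
    Finset.single_le_sum (fun i _ => (hCf0 i).le) (Finset.mem_univ i)
  have hC0 : 0 ≤ ∑ i, Cf i := Finset.sum_nonneg (fun i _ => (hCf0 i).le)
  refine ⟨?_, fun i => ⟨?_, ?_⟩⟩
  · refine (pi_norm_le_iff_of_nonneg (by positivity)).2 fun l => ?_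
    calc ‖(q j l : ℝ)‖ ≤ A * 2 ^ k := (hq2 j).1 l
      _ ≤ A * Q := by gcongr
      _ ≤ _ := by gcongr; linarith
  · refine le_trans ?_ ((hq2 j).2 i).1
    rw [hkpow]
    have h1 := (rpow_cmp (a / 2) a (k / L) (β i - (1 + ε) * m) (by positivity) hkx1 hkx2).1
    have h2 : Finset.univ.inf' hne cf ≤ (k / L) ^ (β i - (1 + ε) * m) :=
      (Finset.inf'_le cf (Finset.mem_univ i)).trans h1
    calc _ ≤ (k / L) ^ (β i - (1 + ε) * m) * ((2 : ℝ) ^ k) ^ (-(τ i / θ)) *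
            L ^ (β i - (1 + ε) * m) := by
          gcongr
          exact hpow1 i
      _ = _ := by ring
  · refine ((hq2 j).2 i).2.trans ?_
    rw [hkpow]
    have h1 := (rpow_cmp (a / 2) a (k / L) (β i) (by positivity) hkx1 hkx2).2
    calc _ ≤ A * ((2 ^ (τ i / θ) * (Q : ℝ) ^ (-(τ i))) *
            (max ((a / 2) ^ (β i)) (a ^ (β i)) * L ^ (β i))) := by
          gcongr
          exact hpow2 i
      _ = Cf i * (Q : ℝ) ^ (-(τ i)) * L ^ (β i) := by rw [hCf]; ring
      _ ≤ _ := by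
          have := hCsum i
          gcongr
          linarith
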